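/- Let k be an algebraically closed field of characteristic 2, let λ ∈ k satisfy λ ≠ 0 and λ³ ≠ 1, and let R = k[X,Y,Z]/(X³+Y³+Z³+λXYZ). Then: (a) the only triple (A,B,C) ∈ R₁ × R₁ × R₁ of linear forms with A·X² + B·Y² + C·Z² = 0 in R is (0,0,0); and (b) for every e ≥ 2, writing q = 2^e, the k-vector space of triples (A,B,C) ∈ R_{q/2} × R_{q/2} × R_{q/2} with A·X^q + B·Y^q + C·Z^q = 0 in R is one-dimensional. -/

import Mathlib

open MvPolynomial

/-- The image in `R = k[X,Y,Z]/I` of the degree-`m` homogeneous component of the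
polynomial ring: this is the degree-`m` component `R_m` of the graded ring `R`. -/
noncomputable def degreeComponent (k : Type*) [Field k]
    (I : Ideal (MvPolynomial (Fin 3) k)) (m : ℕ) :
    Submodule k (MvPolynomial (Fin 3) k ⧸ I) :=
  (homogeneousSubmodule (Fin 3) k m).map (Ideal.Quotient.mkₐ k I).toLinearMap

set_option maxHeartbeats 1000000 in
/-- The `k`-linear map `R³ → R`, `(A,B,C) ↦ A·X^q + B·Y^q + C·Z^q`, on `R = k[X,Y,Z]/I`. -/
noncomputable def syzygyMap (k : Type*) [Field k]
    (I : Ideal (MvPolynomial (Fin 3) k)) (q : ℕ) :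
    (MvPolynomial (Fin 3) k ⧸ I) × (MvPolynomial (Fin 3) k ⧸ I) ×
        (MvPolynomial (Fin 3) k ⧸ I) →ₗ[k] MvPolynomial (Fin 3) k ⧸ I :=
  (LinearMap.mulLeft k (Ideal.Quotient.mk I (X 0 ^ q))).comp (LinearMap.fst k _ _) +
    (LinearMap.mulLeft k (Ideal.Quotient.mk I (X 1 ^ q))).comp
      ((LinearMap.fst k _ _).comp (LinearMap.snd k _ _)) +
    (LinearMap.mulLeft k (Ideal.Quotient.mk I (X 2 ^ q))).comp
      ((LinearMap.snd k _ _).comp (LinearMap.snd k _ _))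

/-- The `k`-vector space of triples `(A,B,C) ∈ (R_m)³` with `A·X^q + B·Y^q + C·Z^q = 0`
in `R = k[X,Y,Z]/I`, i.e. the space of global syzygies of total degree `m + q`. -/
noncomputable def syzygySpace (k : Type*) [Field k]
    (I : Ideal (MvPolynomial (Fin 3) k)) (m q : ℕ) :
    Submodule k ((MvPolynomial (Fin 3) k ⧸ I) × (MvPolynomial (Fin 3) k ⧸ I) ×
      (MvPolynomial (Fin 3) k ⧸ I)) :=
  ((degreeComponent k I m).prod ((degreeComponent k I m).prod (degreeComponent k I m))) ⊓
    LinearMap.ker (syzygyMap k I q)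

/-- The cubic form `X³ + Y³ + Z³ + lXYZ`. -/
noncomputable def hesseCubic {k : Type*} [Field k] (l : k) : MvPolynomial (Fin 3) k :=
  X 0 ^ 3 + X 1 ^ 3 + X 2 ^ 3 + MvPolynomial.C l * (X 0 * X 1 * X 2)

/-- The homogeneous coordinate ring of the cubic `X³ + Y³ + Z³ + lXYZ = 0`. -/
abbrev HesseRing {k : Type*} [Field k] (l : k) : Type _ :=
  MvPolynomial (Fin 3) k ⧸ Ideal.span {hesseCubic l}

section RegularPairs

variable {R : Type*} [CommRing R] {x y : R}

theorem pow_dvd_of_pow_dvd_mul_pow (hx : ∀ p, x * p = 0 → p = 0)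
    (hxy : ∀ p, x ∣ y * p → x ∣ p) (m n : ℕ) (p : R) (h : x ^ m ∣ y ^ n * p) : x ^ m ∣ p := by
  have hy : ∀ n p, x ∣ y ^ n * p → x ∣ p := by
    intro n
    induction n with
    | zero => intro p h; simpa using h
    | succ n ih =>
      intro p h
      refine hxy p (ih _ ?_)
      rwa [← mul_assoc, ← pow_succ]
  induction m generalizing p with
  | zero => simp
  | succ m ih =>
    obtain ⟨p', rfl⟩ := hy n p ((dvd_pow_self x m.succ_ne_zero).trans h)
    obtain ⟨r, hr⟩ := h
    rw [pow_succ']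
    refine mul_dvd_mul_left x (ih p' ⟨r, ?_⟩)
    refine sub_eq_zero.1 (hx _ ?_)
    linear_combination hr

theorem eq_zero_of_pow_mul_eq_zero (hx : ∀ p, x * p = 0 → p = 0) (n : ℕ) (p : R)
    (h : x ^ n * p = 0) : p = 0 := by
  induction n with
  | zero => simpa using h
  | succ n ih => exact ih (hx _ (by rw [← h]; ring))

/-- A vector with vanishing cross product with `(a, b, c)` is a multiple of `(a, b, c)`, provided
the ideal `(a, b, c)` contains a regular pair. -/
theorem exists_eq_mul_of_cross_eq_zero (hx : ∀ p, x * p = 0 → p = 0)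
    (hxy : ∀ p, x ∣ y * p → x ∣ p) {a b c u v w : R}
    (hax : ∃ r s t, x = r * a + s * b + t * c) (hay : ∃ r s t, y = r * a + s * b + t * c)
    (h₁ : v * c = w * b) (h₂ : w * a = u * c) (h₃ : u * b = v * a) :
    ∃ g, u = a * g ∧ v = b * g ∧ w = c * g := by
  obtain ⟨r, s, t, hr⟩ := hax
  obtain ⟨r', s', t', hr'⟩ := hay
  have e₁ : x * u = a * (r * u + s * v + t * w) := by
    rw [hr]; linear_combination s * h₃ - t * h₂
  have e₂ : x * v = b * (r * u + s * v + t * w) := by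
    rw [hr]; linear_combination t * h₁ - r * h₃
  have e₃ : x * w = c * (r * u + s * v + t * w) := by
    rw [hr]; linear_combination r * h₂ - s * h₁
  have f₁ : y * u = a * (r' * u + s' * v + t' * w) := by
    rw [hr']; linear_combination s' * h₃ - t' * h₂
  have f₂ : y * v = b * (r' * u + s' * v + t' * w) := by
    rw [hr']; linear_combination t' * h₁ - r' * h₃
  have f₃ : y * w = c * (r' * u + s' * v + t' * w) := by
    rw [hr']; linear_combination r' * h₂ - s' * h₁
  generalize r * u + s * v + t * w = g at e₁ e₂ e₃
  generalize r' * u + s' * v + t' * w = g' at f₁ f₂ f₃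
  have hg : x * g' - y * g = 0 := by
    refine hx _ ?_
    nth_rewrite 1 [hr]
    linear_combination r * (y * e₁ - x * f₁) + s * (y * e₂ - x * f₂) + t * (y * e₃ - x * f₃)
  obtain ⟨g₀, rfl⟩ := hxy g ⟨g', by linear_combination -hg⟩
  refine ⟨g₀, ?_, ?_, ?_⟩ <;> refine sub_eq_zero.1 (hx _ ?_)
  · linear_combination e₁
  · linear_combination e₂
  · linear_combination e₃

end RegularPairs

section Identities

variable {R : Type*} [CommRing R] [CharP R 2]

theorem quadrics_mul_fourth_powers (x y z l : R) :
    (x ^ 2 + l * (y * z)) * x ^ 4 + (y ^ 2 + l * (z * x)) * y ^ 4 + (z ^ 2 + l * (x * y)) * z ^ 4 =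
      (x ^ 3 + y ^ 3 + z ^ 3 + l * (x * y * z)) * (x ^ 3 + y ^ 3 + z ^ 3) := by
  linear_combination -(x ^ 3 * y ^ 3 + y ^ 3 * z ^ 3 + z ^ 3 * x ^ 3) * CharTwo.two_eq_zero (R := R)

theorem fourth_power_mul_eq (x y z l : R) :
    (1 + l ^ 3) * x ^ 4 = (x ^ 2 + l * (y * z) + l ^ 3 * x ^ 2) * (x ^ 2 + l * (y * z)) +
      l ^ 2 * z ^ 2 * (y ^ 2 + l * (z * x)) + l ^ 3 * (x * z) * (z ^ 2 + l * (x * y)) := by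
  linear_combination -(l * x ^ 2 * y * z + l ^ 2 * y ^ 2 * z ^ 2 + l ^ 4 * x ^ 2 * y * z +
    l ^ 3 * x * z ^ 3) * CharTwo.two_eq_zero (R := R)

end Identities

section Regularity

variable {k : Type*} [Field k] (l : k)

theorem isHomogeneous_hesseCubic : (hesseCubic l).IsHomogeneous 3 := by
  have h (i : Fin 3) : (X i : MvPolynomial (Fin 3) k).IsHomogeneous 1 := isHomogeneous_X k i
  have h3 (i : Fin 3) : (X i ^ 3 : MvPolynomial (Fin 3) k).IsHomogeneous 3 := (h i).pow 3
  refine (((h3 0).add (h3 1)).add (h3 2)).add ?_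
  exact (isHomogeneous_C (Fin 3) l).mul (((h 0).mul (h 1)).mul (h 2))

theorem mk_hesseCubic_eq_zero_iff (p : MvPolynomial (Fin 3) k) :
    Ideal.Quotient.mk (Ideal.span {hesseCubic l}) p = 0 ↔ hesseCubic l ∣ p := by
  rw [Ideal.Quotient.eq_zero_iff_mem, Ideal.mem_span_singleton]

theorem X_zero_mul_eq_zero (p : HesseRing l)
    (h : Ideal.Quotient.mk (Ideal.span {hesseCubic l}) (X 0) * p = 0) : p = 0 := by
  obtain ⟨p, rfl⟩ := Ideal.Quotient.mk_surjective p
  rw [← map_mul, mk_hesseCubic_eq_zero_iff] at h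
  rw [mk_hesseCubic_eq_zero_iff]
  obtain ⟨g, hg⟩ := h
  have hX : Prime (X 0 : MvPolynomial (Fin 3) k) := X_prime
  rcases hX.dvd_or_dvd ⟨p, hg.symm⟩ with h0 | ⟨g', rfl⟩
  · obtain ⟨r, hr⟩ := h0
    have := congrArg (eval ![(0 : k), 1, 0]) hr
    simp [hesseCubic] at this
  · refine ⟨g', mul_left_cancel₀ hX.ne_zero ?_⟩
    rw [hg]; ring

theorem X_zero_dvd_of_dvd_X_one_mul (p : HesseRing l)
    (h : Ideal.Quotient.mk (Ideal.span {hesseCubic l}) (X 0) ∣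
      Ideal.Quotient.mk (Ideal.span {hesseCubic l}) (X 1) * p) :
    Ideal.Quotient.mk (Ideal.span {hesseCubic l}) (X 0) ∣ p := by
  obtain ⟨p, rfl⟩ := Ideal.Quotient.mk_surjective p
  obtain ⟨r, hr⟩ := h
  obtain ⟨r, rfl⟩ := Ideal.Quotient.mk_surjective r
  rw [← map_mul, ← map_mul, ← sub_eq_zero, ← map_sub, mk_hesseCubic_eq_zero_iff] at hr
  obtain ⟨g, hg⟩ := hr
  let φ : MvPolynomial (Fin 3) k →ₐ[k] MvPolynomial (Fin 3) k := aeval ![0, X 1, X 2]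
  have hφ : ∀ f, X 0 ∣ f - φ f := by
    intro f
    induction f using MvPolynomial.induction_on with
    | C a => simp [φ]
    | add f g hf hg => rw [map_add, add_sub_add_comm]; exact dvd_add hf hg
    | mul_X f i hf =>
      have hi : X 0 ∣ (X i : MvPolynomial (Fin 3) k) - φ (X i) := by
        fin_cases i <;> simp [φ]
      have : f * X i - φ (f * X i) = (f - φ f) * X i + φ f * (X i - φ (X i)) := by
        rw [map_mul]; ring
      rw [this]
      exact dvd_add (hf.mul_right _) (hi.mul_left _)
  have hF : φ (hesseCubic l) = X 1 ^ 3 + X 2 ^ 3 := by simp [φ, hesseCubic]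
  have hgφ := congrArg φ hg
  rw [map_sub, map_mul, map_mul, map_mul, hF] at hgφ
  simp only [φ, aeval_X, Matrix.cons_val_zero, Matrix.cons_val_one, zero_mul, sub_zero] at hgφ
  have hX : Prime (X 1 : MvPolynomial (Fin 3) k) := X_prime
  rcases hX.dvd_or_dvd ⟨_, hgφ.symm⟩ with h0 | ⟨g', hg'⟩
  · obtain ⟨r, hr⟩ := h0
    have := congrArg (eval ![(0 : k), 0, 1]) hr
    simp at this
  · have hp : φ p = (X 1 ^ 3 + X 2 ^ 3) * g' := by
      refine mul_left_cancel₀ hX.ne_zero ?_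
      refine hgφ.trans ?_
      rw [hg']; ring
    obtain ⟨s, hs⟩ := hφ p
    refine ⟨Ideal.Quotient.mk _ (s - (X 0 ^ 2 + C l * (X 1 * X 2)) * g'), ?_⟩
    rw [← map_mul, ← sub_eq_zero, ← map_sub, mk_hesseCubic_eq_zero_iff]
    refine ⟨g', ?_⟩
    rw [hesseCubic]
    linear_combination hs + hp

end Regularity

section Degree

variable {k : Type*} [Field k] (l : k)

attribute [local instance] MvPolynomial.gradedAlgebra

theorem homogeneousComponent_mul_eq_mul_C {n : ℕ} {f : MvPolynomial (Fin 3) k}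
    (hf : f.IsHomogeneous n) (h : MvPolynomial (Fin 3) k) :
    homogeneousComponent n (f * h) = f * C (coeff 0 h) := by
  have hdec (p : MvPolynomial (Fin 3) k) (i : ℕ) :
      (DirectSum.decompose (homogeneousSubmodule (Fin 3) k) p i : MvPolynomial (Fin 3) k) =
        homogeneousComponent i p := decomposition.decompose'_apply p i
  have := DirectSum.coe_decompose_mul_add_of_left_mem (homogeneousSubmodule (Fin 3) k)
    (j := 0) (b := h) hf
  rwa [add_zero, hdec, hdec, homogeneousComponent_zero] at this

theorem mk_eq_mul_C_of_mk_eq_mul {n : ℕ} {p f h : MvPolynomial (Fin 3) k}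
    (hp : p.IsHomogeneous n) (hf : f.IsHomogeneous n)
    (H : Ideal.Quotient.mk (Ideal.span {hesseCubic l}) p =
      Ideal.Quotient.mk (Ideal.span {hesseCubic l}) (f * h)) :
    Ideal.Quotient.mk (Ideal.span {hesseCubic l}) p =
      Ideal.Quotient.mk (Ideal.span {hesseCubic l}) (f * C (coeff 0 h)) := by
  rw [Ideal.Quotient.eq] at H ⊢
  have hI : (Ideal.span {hesseCubic l}).IsHomogeneous (homogeneousSubmodule (Fin 3) k) := by
    refine Ideal.homogeneous_span _ _ fun x hx => ⟨3, ?_⟩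
    rw [Set.mem_singleton_iff.1 hx]
    exact isHomogeneous_hesseCubic l
  have := homogeneousComponent_mem_of_mem hI H n
  rwa [map_sub, homogeneousComponent_eq_self hp, homogeneousComponent_mul_eq_mul_C hf] at this

end Degree
section FrobeniusSplitting

variable {k : Type*} [Field k]

/-- The `k`-linear map sending a monomial with all exponents odd, `x^(2u+1)`, to `x^u`, and every
other monomial to zero. -/
noncomputable def oddRoot (k : Type*) [Field k] :
    MvPolynomial (Fin 3) k →ₗ[k] MvPolynomial (Fin 3) k :=
  (basisMonomials (Fin 3) k).constr k fun m =>
    if ∀ i, Odd (m i) then monomial (m.mapRange (· / 2) (Nat.zero_div 2)) 1 else 0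

theorem oddRoot_monomial (m : Fin 3 →₀ ℕ) (a : k) :
    oddRoot k (monomial m a) =
      if ∀ i, Odd (m i) then monomial (m.mapRange (· / 2) (Nat.zero_div 2)) a else 0 := by
  have h : monomial m a = a • basisMonomials (Fin 3) k m := by simp [smul_monomial]
  rw [h, map_smul, oddRoot, Module.Basis.constr_basis]
  split_ifs <;> simp [smul_monomial]

theorem oddRoot_expand_mul (g f : MvPolynomial (Fin 3) k) :
    oddRoot k (expand 2 g * f) = g * oddRoot k f := by
  induction g using MvPolynomial.induction_on' with
  | add g g' hg hg' => rw [map_add, add_mul, map_add, hg, hg', add_mul]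
  | monomial u a =>
    induction f using MvPolynomial.induction_on' with
    | add f f' hf hf' => rw [mul_add, map_add, hf, hf', map_add, mul_add]
    | monomial v b =>
      rw [expand_monomial, monomial_mul, oddRoot_monomial, oddRoot_monomial]
      have hodd : (∀ i, Odd ((2 • u + v) i)) ↔ ∀ i, Odd (v i) := by
        refine forall_congr' fun i => ?_
        simp [Nat.odd_iff]
      have hdiv : (2 • u + v).mapRange (· / 2) (Nat.zero_div 2) =
          u + v.mapRange (· / 2) (Nat.zero_div 2) := by
        ext i
        simp only [Finsupp.mapRange_apply, Finsupp.add_apply, Finsupp.smul_apply, smul_eq_mul]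
        omega
      rw [if_congr hodd rfl rfl, hdiv]
      split_ifs
      · rw [monomial_mul]
      · rw [mul_zero]

theorem oddRoot_hesseCubic (l : k) : oddRoot k (hesseCubic l) = C l := by
  have h1 (i j : Fin 3) (hij : j ≠ i) : oddRoot k (X i ^ 3) = 0 := by
    rw [X_pow_eq_monomial, oddRoot_monomial, if_neg]
    intro h
    have := h j
    rw [Finsupp.single_eq_of_ne hij] at this
    exact absurd this (by decide)
  have h2 : (C l * (X 0 * X 1 * X 2) : MvPolynomial (Fin 3) k) =
      monomial (Finsupp.single 0 1 + Finsupp.single 1 1 + Finsupp.single 2 1) l := by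
    simp only [X, monomial_mul, C_mul_monomial, mul_one]
  rw [hesseCubic, map_add, map_add, map_add, h1 0 1 (by decide), h1 1 0 (by decide),
    h1 2 0 (by decide), h2, oddRoot_monomial, if_pos]
  · have : (Finsupp.single 0 1 + Finsupp.single 1 1 + Finsupp.single 2 1 : Fin 3 →₀ ℕ).mapRange
        (· / 2) (Nat.zero_div 2) = 0 := by
      ext i
      fin_cases i <;> simp
    rw [this]
    simp
  · intro i
    fin_cases i <;> simp

variable [CharP k 2]

theorem oddRoot_sq_mul (g f : MvPolynomial (Fin 3) k) :
    oddRoot k (g ^ 2 * f) = map (frobenius k 2) g * oddRoot k f := by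
  rw [← oddRoot_expand_mul, ← map_expand, map_frobenius_expand]

variable [PerfectRing k 2]

/-- The cubic `X³ + Y³ + Z³ + lXYZ` with `l ≠ 0` is `F`-pure in characteristic two, one step of
Frobenius at a time. -/
theorem mem_of_sq_mem {l : k} (hl : l ≠ 0) {f a b : MvPolynomial (Fin 3) k}
    (h : ∃ r s t, f ^ 2 = r * a ^ 2 + s * b ^ 2 + t * hesseCubic l) :
    ∃ r s t, f = r * a + s * b + t * hesseCubic l := by
  obtain ⟨r, s, t, h⟩ := h
  have hF : f ^ 2 * hesseCubic l =
      a ^ 2 * (r * hesseCubic l) + b ^ 2 * (s * hesseCubic l) + hesseCubic l ^ 2 * t := by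
    rw [h]; ring
  have hτ := congrArg (oddRoot k) hF
  simp only [map_add, oddRoot_sq_mul, oddRoot_hesseCubic] at hτ
  set σ : k →+* k := (frobeniusEquiv k 2).symm.toRingHom with hσ
  have hid : ∀ g : MvPolynomial (Fin 3) k, map σ (map (frobenius k 2) g) = g := by
    intro g
    rw [map_map, hσ]
    exact (congrArg (fun τ => map τ g) (frobeniusEquiv_symm_comp_frobenius k 2)).trans (map_id g)
  have h' := congrArg (map σ) hτ
  simp only [map_add, map_mul, hid, map_C] at h'
  have hl' : σ l ≠ 0 := by simpa [hσ] using hl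
  have hC : (C (σ l)⁻¹ * C (σ l) : MvPolynomial (Fin 3) k) = 1 := by
    rw [← C_mul, inv_mul_cancel₀ hl', C_1]
  refine ⟨C (σ l)⁻¹ * map σ (oddRoot k (r * hesseCubic l)),
    C (σ l)⁻¹ * map σ (oddRoot k (s * hesseCubic l)), C (σ l)⁻¹ * map σ (oddRoot k t), ?_⟩
  linear_combination C (σ l)⁻¹ * h' - f * hC

theorem mem_of_pow_two_pow_mem {l : k} (hl : l ≠ 0) (n : ℕ) {f a b : MvPolynomial (Fin 3) k}
    (h : ∃ r s t, f ^ 2 ^ n = r * a ^ 2 ^ n + s * b ^ 2 ^ n + t * hesseCubic l) :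
    ∃ r s t, f = r * a + s * b + t * hesseCubic l := by
  induction n with
  | zero => simpa using h
  | succ n ih => exact ih (mem_of_sq_mem hl (by simpa only [pow_succ 2, pow_mul] using h))

end FrobeniusSplitting

section Coefficients

variable {k : Type*} [Field k]

/-- The coefficient of `X^a Y^b Z^d`. -/
noncomputable def coeffAt (a b d : ℕ) (p : MvPolynomial (Fin 3) k) : k :=
  coeff (Finsupp.equivFunOnFinite.symm ![a, b, d]) p

theorem coeff_vec_X_mul (i : Fin 3) (m : Fin 3 → ℕ) (p : MvPolynomial (Fin 3) k) :
    coeff (Finsupp.equivFunOnFinite.symm m) (X i * p) =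
      if m i = 0 then 0 else coeff (Finsupp.equivFunOnFinite.symm (m - Pi.single i 1)) p := by
  classical
  rw [coeff_X_mul']
  simp only [Finsupp.mem_support_iff, Finsupp.equivFunOnFinite_symm_apply_apply, ne_eq, ite_not]
  congr 2
  ext j
  by_cases h : j = i
  · subst h; simp
  · simp [h]

theorem coeffAt_add (a b d : ℕ) (p q : MvPolynomial (Fin 3) k) :
    coeffAt a b d (p + q) = coeffAt a b d p + coeffAt a b d q :=
  coeff_add _ _ _

theorem coeffAt_C_mul (a b d : ℕ) (x : k) (p : MvPolynomial (Fin 3) k) :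
    coeffAt a b d (C x * p) = x * coeffAt a b d p :=
  coeff_C_mul _ _ _

theorem coeffAt_X_zero_mul (a b d : ℕ) (p : MvPolynomial (Fin 3) k) :
    coeffAt a b d (X 0 * p) = if a = 0 then 0 else coeffAt (a - 1) b d p := by
  have h : ![a, b, d] - Pi.single 0 1 = ![a - 1, b, d] := by
    ext i; fin_cases i <;> simp
  simp only [coeffAt, coeff_vec_X_mul, h, Matrix.cons_val_zero]

theorem coeffAt_X_one_mul (a b d : ℕ) (p : MvPolynomial (Fin 3) k) :
    coeffAt a b d (X 1 * p) = if b = 0 then 0 else coeffAt a (b - 1) d p := by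
  have h : ![a, b, d] - Pi.single 1 1 = ![a, b - 1, d] := by
    ext i; fin_cases i <;> simp
  simp only [coeffAt, coeff_vec_X_mul, h, Matrix.cons_val_one, Matrix.cons_val_zero]

theorem coeffAt_X_two_mul (a b d : ℕ) (p : MvPolynomial (Fin 3) k) :
    coeffAt a b d (X 2 * p) = if d = 0 then 0 else coeffAt a b (d - 1) p := by
  have h : ![a, b, d] - Pi.single 2 1 = ![a, b, d - 1] := by
    ext i; fin_cases i <;> simp
  simp only [coeffAt, coeff_vec_X_mul, h, Matrix.cons_val]

theorem coeffAt_zero_one : coeffAt 0 0 0 (1 : MvPolynomial (Fin 3) k) = 1 := by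
  have h : Finsupp.equivFunOnFinite.symm ![0, 0, 0] = (0 : Fin 3 →₀ ℕ) := by
    ext i; fin_cases i <;> simp
  simp only [coeffAt, h, coeff_zero_one]

theorem X_two_pow_four_notMem [CharP k 2] {l : k} (hl : l ≠ 0) :
    ¬ ∃ r s t, (X 2 ^ 4 : MvPolynomial (Fin 3) k) =
      r * (X 0 ^ 2 + C l * (X 1 * X 2)) + s * (X 1 ^ 2 + C l * (X 2 * X 0)) +
        t * hesseCubic l := by
  rintro ⟨r, s, t, h⟩
  -- this functional vanishes on the ideal in degree four
  let φ (p : MvPolynomial (Fin 3) k) : k := l * coeffAt 0 0 4 p + coeffAt 1 1 2 p +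
    l * coeffAt 3 0 1 p + l * coeffAt 0 3 1 p + l ^ 2 * coeffAt 2 2 0 p
  have h' := congrArg φ h
  have e1 : (X 2 ^ 4 : MvPolynomial (Fin 3) k) = X 2 * (X 2 * (X 2 * (X 2 * 1))) := by ring
  have e2 : r * (X 0 ^ 2 + C l * (X 1 * X 2)) + s * (X 1 ^ 2 + C l * (X 2 * X 0)) +
      t * hesseCubic l = X 0 * (X 0 * r) + C l * (X 1 * (X 2 * r)) +
      (X 1 * (X 1 * s) + C l * (X 2 * (X 0 * s))) +
      (X 0 * (X 0 * (X 0 * t)) + X 1 * (X 1 * (X 1 * t)) + X 2 * (X 2 * (X 2 * t)) +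
        C l * (X 0 * (X 1 * (X 2 * t)))) := by
    rw [hesseCubic]; ring
  rw [e1, e2] at h'
  norm_num [φ, coeffAt_add, coeffAt_C_mul, coeffAt_X_zero_mul, coeffAt_X_one_mul,
    coeffAt_X_two_mul, coeffAt_zero_one, -mul_one] at h'
  refine hl ?_
  linear_combination h' + (l * coeffAt 1 0 1 r + l ^ 2 * coeffAt 0 2 0 r + l * coeffAt 0 1 1 s +
    l ^ 2 * coeffAt 2 0 0 s + 2 * l * coeffAt 0 0 1 t) * CharTwo.two_eq_zero (R := k)

/-- The linear forms killed by `(X², Y², Z²)` modulo the cubic vanish. -/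
theorem eq_zero_of_linear_syzygy {l c : k} (hl : l ≠ 0) {f g h : MvPolynomial (Fin 3) k}
    (hf : f.IsHomogeneous 1) (hg : g.IsHomogeneous 1) (hh : h.IsHomogeneous 1)
    (H : X 0 ^ 2 * f + X 1 ^ 2 * g + X 2 ^ 2 * h = hesseCubic l * C c) :
    f = 0 ∧ g = 0 ∧ h = 0 := by
  have hlin {p : MvPolynomial (Fin 3) k} (hp : p.IsHomogeneous 1) :
      ∃ u : Fin 3 → k, p = X 0 * (C (u 0) * 1) + X 1 * (C (u 1) * 1) + X 2 * (C (u 2) * 1) := by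
    rw [← mem_homogeneousSubmodule, homogeneousSubmodule_one_eq_span_X,
      Submodule.mem_span_range_iff_exists_fun] at hp
    obtain ⟨u, rfl⟩ := hp
    refine ⟨u, ?_⟩
    simp only [Fin.sum_univ_three, smul_eq_C_mul]
    ring
  obtain ⟨u, rfl⟩ := hlin hf
  obtain ⟨v, rfl⟩ := hlin hg
  obtain ⟨w, rfl⟩ := hlin hh
  have e : hesseCubic l * C c = X 0 * (X 0 * (X 0 * (C c * 1))) + X 1 * (X 1 * (X 1 * (C c * 1))) +
      X 2 * (X 2 * (X 2 * (C c * 1))) + C l * (X 0 * (X 1 * (X 2 * (C c * 1)))) := by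
    rw [hesseCubic]; ring
  rw [e] at H
  simp only [pow_two, mul_assoc] at H
  have key (a b d : ℕ) := congrArg (coeffAt a b d) H
  simp only [mul_add, coeffAt_add, coeffAt_C_mul, coeffAt_X_zero_mul, coeffAt_X_one_mul,
    coeffAt_X_two_mul] at key
  have hc : c = 0 := by simpa [coeffAt_zero_one, hl] using key 1 1 1
  subst hc
  have hu0 := key 3 0 0
  have hu1 := key 2 1 0
  have hu2 := key 2 0 1
  have hv0 := key 1 2 0
  have hv1 := key 0 3 0
  have hv2 := key 0 2 1
  have hw0 := key 1 0 2
  have hw1 := key 0 1 2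
  have hw2 := key 0 0 3
  norm_num [coeffAt_zero_one] at hu0 hu1 hu2 hv0 hv1 hv2 hw0 hw1 hw2
  simp [*]

end Coefficients

section Syzygies

variable {k : Type*} [Field k]

theorem mem_syzygySpace_iff {I : Ideal (MvPolynomial (Fin 3) k)} {m q : ℕ}
    {p : (MvPolynomial (Fin 3) k ⧸ I) × (MvPolynomial (Fin 3) k ⧸ I) ×
      (MvPolynomial (Fin 3) k ⧸ I)} :
    p ∈ syzygySpace k I m q ↔ ∃ f g h : MvPolynomial (Fin 3) k,
      f.IsHomogeneous m ∧ g.IsHomogeneous m ∧ h.IsHomogeneous m ∧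
      p = (Ideal.Quotient.mk I f, Ideal.Quotient.mk I g, Ideal.Quotient.mk I h) ∧
      X 0 ^ q * f + X 1 ^ q * g + X 2 ^ q * h ∈ I := by
  obtain ⟨u, v, w⟩ := p
  have hmap : syzygyMap k I q (u, v, w) = Ideal.Quotient.mk I (X 0 ^ q) * u +
    Ideal.Quotient.mk I (X 1 ^ q) * v + Ideal.Quotient.mk I (X 2 ^ q) * w := rfl
  rw [syzygySpace, Submodule.mem_inf, LinearMap.mem_ker, hmap]
  constructor
  · rintro ⟨⟨⟨f, hf, rfl⟩, ⟨g, hg, rfl⟩, ⟨h, hh, rfl⟩⟩, H⟩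
    refine ⟨f, g, h, hf, hg, hh, rfl, Ideal.Quotient.eq_zero_iff_mem.1 ?_⟩
    rw [map_add, map_add, map_mul, map_mul, map_mul]
    exact H
  · rintro ⟨f, g, h, hf, hg, hh, hp, H⟩
    obtain ⟨rfl, rfl, rfl⟩ : u = _ ∧ v = _ ∧ w = _ := by simpa using hp
    refine ⟨⟨⟨f, hf, rfl⟩, ⟨g, hg, rfl⟩, ⟨h, hh, rfl⟩⟩, ?_⟩
    rw [← map_mul, ← map_mul, ← map_mul, ← map_add, ← map_add, Ideal.Quotient.eq_zero_iff_mem]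
    exact H

theorem syzygySpace_hesseCubic_one_two {l : k} (hl : l ≠ 0) :
    syzygySpace k (Ideal.span {hesseCubic l}) 1 2 = ⊥ := by
  refine (Submodule.eq_bot_iff _).2 fun p hp => ?_
  obtain ⟨f, g, h, hf, hg, hh, rfl, H⟩ := mem_syzygySpace_iff.1 hp
  obtain ⟨r, hr⟩ := Ideal.mem_span_singleton.1 H
  have hX (i : Fin 3) : (X i ^ 2 : MvPolynomial (Fin 3) k).IsHomogeneous 2 :=
    (isHomogeneous_X k i).pow 2
  have hP : (X 0 ^ 2 * f + X 1 ^ 2 * g + X 2 ^ 2 * h).IsHomogeneous 3 :=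
    (((hX 0).mul hf).add ((hX 1).mul hg)).add ((hX 2).mul hh)
  have hdeg := congrArg (homogeneousComponent 3) hr
  rw [homogeneousComponent_eq_self hP,
    homogeneousComponent_mul_eq_mul_C (isHomogeneous_hesseCubic l)] at hdeg
  obtain ⟨rfl, rfl, rfl⟩ := eq_zero_of_linear_syzygy hl hf hg hh hdeg
  simp

/-- The partial derivatives of the cubic `X³ + Y³ + Z³ + lXYZ` in characteristic two. -/
noncomputable def hesseGradient (l : k) (i : Fin 3) : MvPolynomial (Fin 3) k :=
  X i ^ 2 + C l * (X (i + 1) * X (i + 2))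

theorem isHomogeneous_hesseGradient_pow (l : k) (i : Fin 3) (n : ℕ) :
    (hesseGradient l i ^ n).IsHomogeneous (2 * n) := by
  have h (i : Fin 3) : (X i : MvPolynomial (Fin 3) k).IsHomogeneous 1 := isHomogeneous_X k i
  exact (((h i).pow 2).add ((isHomogeneous_C (Fin 3) l).mul ((h _).mul (h _)))).pow n

variable [CharP k 2]

theorem hesseCubic_dvd_syzygy (l : k) (n : ℕ) :
    hesseCubic l ∣ X 0 ^ 2 ^ (n + 2) * hesseGradient l 0 ^ 2 ^ n +
      X 1 ^ 2 ^ (n + 2) * hesseGradient l 1 ^ 2 ^ n +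
      X 2 ^ 2 ^ (n + 2) * hesseGradient l 2 ^ 2 ^ n := by
  have h := quadrics_mul_fourth_powers (X 0) (X 1) (X 2) (C l : MvPolynomial (Fin 3) k)
  have h' : X 0 ^ 2 ^ (n + 2) * hesseGradient l 0 ^ 2 ^ n +
      X 1 ^ 2 ^ (n + 2) * hesseGradient l 1 ^ 2 ^ n +
      X 2 ^ 2 ^ (n + 2) * hesseGradient l 2 ^ 2 ^ n =
      (hesseCubic l * (X 0 ^ 3 + X 1 ^ 3 + X 2 ^ 3)) ^ 2 ^ n := by
    rw [hesseCubic, ← h, add_pow_char_pow, add_pow_char_pow, mul_pow, mul_pow, mul_pow,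
      ← pow_mul, ← pow_mul, ← pow_mul, show 4 * 2 ^ n = 2 ^ (n + 2) by ring]
    rw [hesseGradient, hesseGradient, hesseGradient, show (1 + 1 : Fin 3) = 2 from rfl,
      show (1 + 2 : Fin 3) = 0 from rfl, show (2 + 1 : Fin 3) = 0 from rfl,
      show (2 + 2 : Fin 3) = 1 from rfl, zero_add, zero_add]
    ring
  rw [h', mul_pow]
  exact (dvd_pow_self _ (by positivity)).mul_right _

theorem X_pow_mem_span_hesseGradient_pow {l : k} (hl3 : l ^ 3 ≠ 1) (n : ℕ) (i : Fin 3) :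
    ∃ r s t, (X i ^ 2 ^ (n + 2) : MvPolynomial (Fin 3) k) =
      r * hesseGradient l i ^ 2 ^ n + s * hesseGradient l (i + 1) ^ 2 ^ n +
        t * hesseGradient l (i + 2) ^ 2 ^ n := by
  have h := fourth_power_mul_eq (X i) (X (i + 1)) (X (i + 2)) (C l : MvPolynomial (Fin 3) k)
  have hl' : 1 + l ^ 3 ≠ 0 := fun h0 => hl3 (CharTwo.add_eq_zero.1 h0).symm
  have hC : (C (1 + l ^ 3)⁻¹ * (1 + C l ^ 3) : MvPolynomial (Fin 3) k) = 1 := by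
    rw [← C_pow, ← C_1, ← C_add, ← C_mul, inv_mul_cancel₀ hl']
  have e1 : i + 1 + 1 = i + 2 := by rw [add_assoc]; rfl
  have e2 : i + 1 + 2 = i := by rw [add_assoc]; exact add_zero i
  have e3 : i + 2 + 1 = i := by rw [add_assoc]; exact add_zero i
  have e4 : i + 2 + 2 = i + 1 := by rw [add_assoc]; rfl
  obtain ⟨r, s, t, h'⟩ : ∃ r s t, ((1 + C l ^ 3) * X i ^ 4 : MvPolynomial (Fin 3) k) =
      r * hesseGradient l i + s * hesseGradient l (i + 1) + t * hesseGradient l (i + 2) := by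
    simp only [hesseGradient, e1, e2, e3, e4]
    exact ⟨_, _, _, h⟩
  have h4 : (X i ^ 4 : MvPolynomial (Fin 3) k) = C (1 + l ^ 3)⁻¹ * r * hesseGradient l i +
      C (1 + l ^ 3)⁻¹ * s * hesseGradient l (i + 1) +
      C (1 + l ^ 3)⁻¹ * t * hesseGradient l (i + 2) := by
    linear_combination C (1 + l ^ 3)⁻¹ * h' - X i ^ 4 * hC
  refine ⟨(C (1 + l ^ 3)⁻¹ * r) ^ 2 ^ n, (C (1 + l ^ 3)⁻¹ * s) ^ 2 ^ n,
    (C (1 + l ^ 3)⁻¹ * t) ^ 2 ^ n, ?_⟩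
  rw [← mul_pow, ← mul_pow, ← mul_pow, ← add_pow_char_pow, ← add_pow_char_pow, ← h4, ← pow_mul]
  congr 1
  ring

variable [PerfectRing k 2]

theorem finrank_syzygySpace_hesseCubic {l : k} (hl : l ≠ 0) (hl3 : l ^ 3 ≠ 1) (n : ℕ) :
    Module.finrank k
      (syzygySpace k (Ideal.span {hesseCubic l}) (2 * 2 ^ n) (2 ^ (n + 2))) = 1 := by
  set π := Ideal.Quotient.mk (Ideal.span {hesseCubic l}) with hπ
  have hx := X_zero_mul_eq_zero l
  have hxy := X_zero_dvd_of_dvd_X_one_mul l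
  rw [← hπ] at hx hxy
  have hxq := eq_zero_of_pow_mul_eq_zero hx (2 ^ (n + 2))
  have hxyq := pow_dvd_of_pow_dvd_mul_pow hx hxy (2 ^ (n + 2)) (2 ^ (n + 2))
  have hX (i : Fin 3) : ∃ r s t, π (X i) ^ 2 ^ (n + 2) = r * π (hesseGradient l 0 ^ 2 ^ n) +
      s * π (hesseGradient l 1 ^ 2 ^ n) + t * π (hesseGradient l 2 ^ 2 ^ n) := by
    obtain ⟨r, s, t, h⟩ := X_pow_mem_span_hesseGradient_pow hl3 n i
    rw [← map_pow, h, map_add, map_add, map_mul, map_mul, map_mul]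
    fin_cases i
    · exact ⟨π r, π s, π t, rfl⟩
    · exact ⟨π t, π r, π s, by simp only [Fin.mk_one, Fin.isValue, Fin.reduceAdd]; ring⟩
    · exact ⟨π s, π t, π r, by simp only [Fin.reduceFinMk, Fin.isValue, Fin.reduceAdd]; ring⟩
  set a : Fin 3 → HesseRing l := fun i => π (hesseGradient l i ^ 2 ^ n) with ha
  have hgrad : π (X 0) ^ 2 ^ (n + 2) * a 0 + π (X 1) ^ 2 ^ (n + 2) * a 1 +
      π (X 2) ^ 2 ^ (n + 2) * a 2 = 0 := by
    have := (mk_hesseCubic_eq_zero_iff l _).2 (hesseCubic_dvd_syzygy l n)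
    simpa only [ha, hπ, map_add, map_mul, map_pow] using this
  have hne : (a 0, a 1, a 2) ≠ 0 := by
    intro h0
    simp only [Prod.mk_eq_zero] at h0
    obtain ⟨r, s, t, h⟩ := hX 0
    change _ = r * a 0 + s * a 1 + t * a 2 at h
    rw [h0.1, h0.2.1, h0.2.2, mul_zero, mul_zero, mul_zero, add_zero, add_zero] at h
    have h1 := hxq (π 1) (by rw [h, zero_mul])
    obtain ⟨r, hr⟩ := (mk_hesseCubic_eq_zero_iff l _).1 h1
    simpa [hesseCubic] using congrArg (eval ![(0 : k), 0, 0]) hr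
  suffices h : syzygySpace k (Ideal.span {hesseCubic l}) (2 * 2 ^ n) (2 ^ (n + 2)) =
      Submodule.span k {(a 0, a 1, a 2)} by
    rw [h, finrank_span_singleton hne]
  refine le_antisymm (fun p hp => ?_) ((Submodule.span_singleton_le_iff_mem _ _).2 ?_)
  · obtain ⟨f, g, h, hf, hg, hh, rfl, H⟩ := mem_syzygySpace_iff.1 hp
    have H' := Ideal.Quotient.eq_zero_iff_mem.2 H
    rw [← hπ] at H'
    simp only [map_add, map_mul, map_pow] at H'
    have h12 : π (X 1) ^ 2 ^ (n + 2) * (π g * a 2 - π h * a 1) =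
        π (X 0) ^ 2 ^ (n + 2) * (π h * a 0 - π f * a 2) := by
      linear_combination a 2 * H' - π h * hgrad
    have h13 : π (X 2) ^ 2 ^ (n + 2) * (π g * a 2 - π h * a 1) =
        π (X 0) ^ 2 ^ (n + 2) * (π f * a 1 - π g * a 0) := by
      linear_combination π g * hgrad - a 1 * H'
    obtain ⟨r, hr⟩ := hxyq _ ⟨_, h12⟩
    obtain ⟨r, rfl⟩ := Ideal.Quotient.mk_surjective r
    have hdeg : 2 * 2 ^ n + 2 * 2 ^ n = 2 ^ (n + 2) := by ring
    have hcross : (g * hesseGradient l 2 ^ 2 ^ n - h * hesseGradient l 1 ^ 2 ^ n).IsHomogeneous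
        (2 ^ (n + 2)) := by
      rw [← hdeg]
      exact (hg.mul (isHomogeneous_hesseGradient_pow l 2 _)).sub
        (hh.mul (isHomogeneous_hesseGradient_pow l 1 _))
    have hXq : (X 0 ^ 2 ^ (n + 2) : MvPolynomial (Fin 3) k).IsHomogeneous (2 ^ (n + 2)) := by
      simpa using (isHomogeneous_X k (0 : Fin 3)).pow (2 ^ (n + 2))
    have hr' := mk_eq_mul_C_of_mk_eq_mul l (h := r) hcross hXq
      (by rw [← hπ, map_sub, map_mul, map_mul, map_mul, map_pow π (X 0)]; exact hr)
    rw [← hπ, map_sub, map_mul, map_mul, map_mul, map_pow π (X 0)] at hr'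
    change π g * a 2 - π h * a 1 = _ at hr'
    generalize coeff 0 r = c at hr'
    have h2 : π h * a 0 - π f * a 2 = π (X 1) ^ 2 ^ (n + 2) * π (C c) := by
      refine sub_eq_zero.1 (hxq _ ?_)
      linear_combination π (X 1) ^ 2 ^ (n + 2) * hr' - h12
    have h3 : π f * a 1 - π g * a 0 = π (X 2) ^ 2 ^ (n + 2) * π (C c) := by
      refine sub_eq_zero.1 (hxq _ ?_)
      linear_combination π (X 2) ^ 2 ^ (n + 2) * hr' - h13
    obtain rfl : c = 0 := by
      by_contra hc
      refine X_two_pow_four_notMem hl (mem_of_pow_two_pow_mem hl n ?_)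
      have h3' : π (X 2 ^ 2 ^ (n + 2) * C c -
          (f * hesseGradient l 1 ^ 2 ^ n - g * hesseGradient l 0 ^ 2 ^ n)) = 0 := by
        rw [map_sub, map_mul, map_pow π (X 2), ← h3, map_sub, map_mul, map_mul, sub_self]
      obtain ⟨t, ht⟩ := (mk_hesseCubic_eq_zero_iff l _).1 h3'
      have hC : (C c * C c⁻¹ : MvPolynomial (Fin 3) k) = 1 := by
        rw [← C_mul, mul_inv_cancel₀ hc, C_1]
      refine ⟨-C c⁻¹ * g, C c⁻¹ * f, C c⁻¹ * t, ?_⟩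
      change _ = _ * hesseGradient l 0 ^ 2 ^ n + _ * hesseGradient l 1 ^ 2 ^ n + _
      rw [← pow_mul, show 4 * 2 ^ n = 2 ^ (n + 2) by ring]
      linear_combination C c⁻¹ * ht - X 2 ^ 2 ^ (n + 2) * hC
    rw [C_0, map_zero, mul_zero, sub_eq_zero] at hr' h2 h3
    obtain ⟨G, hfG, hgG, hhG⟩ :=
      exists_eq_mul_of_cross_eq_zero hxq hxyq (hX 0) (hX 1) hr' h2 h3
    obtain ⟨G, rfl⟩ := Ideal.Quotient.mk_surjective G
    have hscalar {p : MvPolynomial (Fin 3) k} {i : Fin 3} (hp : p.IsHomogeneous (2 * 2 ^ n))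
        (hpG : π p = a i * π G) : coeff 0 G • a i = π p := by
      have := mk_eq_mul_C_of_mk_eq_mul l hp (isHomogeneous_hesseGradient_pow l i _)
        (by rw [← hπ, map_mul]; exact hpG)
      rw [← hπ, mul_comm, ← smul_eq_C_mul] at this
      exact this.symm
    refine Submodule.mem_span_singleton.2 ⟨coeff 0 G, ?_⟩
    rw [Prod.smul_mk, Prod.smul_mk, hscalar hf hfG, hscalar hg hgG, hscalar hh hhG]
  · exact mem_syzygySpace_iff.2 ⟨_, _, _, isHomogeneous_hesseGradient_pow l 0 _,
      isHomogeneous_hesseGradient_pow l 1 _, isHomogeneous_hesseGradient_pow l 2 _, rfl,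
      Ideal.mem_span_singleton.2 (hesseCubic_dvd_syzygy l n)⟩

end Syzygies

set_option maxHeartbeats 2000000 in
/-- For the smooth plane cubic `R = k[X,Y,Z]/(X³+Y³+Z³+λXYZ)` of Hasse invariant `1`
(`λ ≠ 0`, `λ³ ≠ 1`) in characteristic `2`: (a) the only triple of linear forms `(A,B,C)`
with `A·X² + B·Y² + C·Z² = 0` in `R` is `(0,0,0)`; and (b) for `q = 2^e` with `e ≥ 2`, the
space of triples `(A,B,C) ∈ (R_{q/2})³` with `A·X^q + B·Y^q + C·Z^q = 0` in `R` is
one-dimensional. -/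
theorem hasse_one_cubic_frobenius_syzygies_char_two
    (k : Type*) [Field k] [IsAlgClosed k] [CharP k 2]
    (l : k) (hl : l ≠ 0) (hl3 : l ^ 3 ≠ 1) :
    syzygySpace k
        (Ideal.span
          {(X 0 ^ 3 + X 1 ^ 3 + X 2 ^ 3 + MvPolynomial.C l * (X 0 * X 1 * X 2) :
            MvPolynomial (Fin 3) k)}) 1 2 = ⊥ ∧
      ∀ e : ℕ, 2 ≤ e →
        Module.finrank k
          (syzygySpace k
            (Ideal.span
              {(X 0 ^ 3 + X 1 ^ 3 + X 2 ^ 3 + MvPolynomial.C l * (X 0 * X 1 * X 2) :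
                MvPolynomial (Fin 3) k)}) (2 ^ e / 2) (2 ^ e)) = 1 := by
  refine ⟨syzygySpace_hesseCubic_one_two hl, fun e he => ?_⟩
  obtain ⟨n, rfl⟩ := Nat.exists_eq_add_of_le' he
  have hdiv : 2 ^ (n + 2) / 2 = 2 * 2 ^ n := by rw [pow_add]; omega
  rw [hdiv]
  exact finrank_syzygySpace_hesseCubic hl hl3 n
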